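/- If m ∈ G(I^k), s ∈ set(m), and x_s·m/x_{min(m)} ≺ v^k, then g(x_s·m) = x_s·m/x_{min(m̃)}; that is, x_s·m/x_{min(m̃)} ∈ G(I^k) and every w ∈ G(I^k) dividing x_s·m satisfies w ≥_revlex x_s·m/x_{min(m̃)}, where m̃ is the part of m supported in x_{l+1},…,x_n. -/

import Mathlib

open MvPolynomial Finset

/-- A monomial in `n` variables, recorded by its exponent vector
(index `i : Fin n` corresponds to the variable `x_{i+1}` of the paper). -/
abbrev Mon (n : ℕ) := Fin n →₀ ℕ

/-- The exponent vector of the single variable `x_{j+1}` (`0`-indexed `j`). -/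
noncomputable def sing (n j : ℕ) : Mon n :=
  Finsupp.onFinset Finset.univ (fun i => if (i : ℕ) = j then 1 else 0)
    (fun a _ => Finset.mem_univ a)

/-- Total degree of a monomial. -/
def deg {n : ℕ} (m : Mon n) : ℕ := m.sum fun _ e => e

/-- `m₁ <_lex m₂` for the lexicographic order with `x_1 > x_2 > ⋯ > x_n`. -/
def lexLT {n : ℕ} (m₁ m₂ : Mon n) : Prop :=
  ∃ i : Fin n, (∀ j : Fin n, j < i → m₁ j = m₂ j) ∧ m₁ i < m₂ i

def lexLE {n : ℕ} (m₁ m₂ : Mon n) : Prop := m₁ = m₂ ∨ lexLT m₁ m₂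

/-- `m₁ <_revlex m₂` : the increasing reverse lexicographic order. -/
def revLT {n : ℕ} (m₁ m₂ : Mon n) : Prop :=
  ∃ s : Fin n, (∀ i : Fin n, s < i → m₁ i = m₂ i) ∧ m₂ s < m₁ s

def revLE {n : ℕ} (m₁ m₂ : Mon n) : Prop := m₁ = m₂ ∨ revLT m₁ m₂

/-- `min(m)`: the (0-indexed) smallest index in the support of `m`. -/
noncomputable def minIdx {n : ℕ} (m : Mon n) : ℕ := sInf {j : ℕ | ∃ h : j < n, m ⟨j, h⟩ ≠ 0}

/-- `m̄`: the part of `m` supported in the variables `x_1, …, x_l`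
(0-indexed: indices `< l`). -/
noncomputable def lowPart {n : ℕ} (l : ℕ) (m : Mon n) : Mon n :=
  m.filter fun i => (i : ℕ) < l

/-- `m̃`: the part of `m` supported in the variables `x_{l+1}, …, x_n`
(0-indexed: indices `≥ l`). -/
noncomputable def highPart {n : ℕ} (l : ℕ) (m : Mon n) : Mon n :=
  m.filter fun i => l ≤ (i : ℕ)

/-- The exponent vector of `u = x_1 · x_{l+1}^{a_{l+1}} ⋯ x_n^{a_n}`, where
`a j` (for `l ≤ j < n`, 0-indexed) is the exponent of `x_{j+1}`. -/
noncomputable def uVec (n l : ℕ) (a : ℕ → ℕ) : Mon n :=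
  sing n 0 + ∑ j ∈ Finset.Ico l n, a j • sing n j

/-- The exponent vector of `v = x_l · x_n^{d-1}`. -/
noncomputable def vVec (n l d : ℕ) : Mon n :=
  sing n (l - 1) + (d - 1) • sing n (n - 1)

/-- The lexsegment `L(u,v)`: monomials `w` of degree `d` with `u ≥_lex w ≥_lex v`. -/
def lexSeg (n l d : ℕ) (a : ℕ → ℕ) : Set (Mon n) :=
  { w | deg w = d ∧ lexLE (vVec n l d) w ∧ lexLE w (uVec n l a) }

/-- The lexsegment ideal `I = (L(u,v)) ⊆ K[x_1,…,x_n]`. -/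
noncomputable def lexIdeal (n l d : ℕ) (a : ℕ → ℕ) (K : Type*) [Field K] :
    Ideal (MvPolynomial (Fin n) K) :=
  Ideal.span ((fun w => monomial w (1 : K)) '' lexSeg n l d a)

/-- `G(J)`: the minimal monomial generators of a monomial ideal `J`, i.e.
monomials `m ∈ J` with `m / x_i ∉ J` for every `i ∈ supp m`. -/
def minGens {n : ℕ} (K : Type*) [Field K] (J : Ideal (MvPolynomial (Fin n) K)) :
    Set (Mon n) :=
  { m | monomial m (1 : K) ∈ J ∧
      ∀ i ∈ m.support, monomial (m - Finsupp.single i 1) (1 : K) ∉ J }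

/-- `J_{<revlex m}`: the ideal generated by all `z ∈ G(J)` with `z <_revlex m`. -/
noncomputable def idealBelow {n : ℕ} (K : Type*) [Field K]
    (J : Ideal (MvPolynomial (Fin n) K)) (m : Mon n) : Ideal (MvPolynomial (Fin n) K) :=
  Ideal.span ((fun z => monomial z (1 : K)) '' { z | z ∈ minGens K J ∧ revLT z m })

/-- `set(m) = {j : x_j · m ∈ J_{<revlex m}}` (0-indexed). -/
def setOfGen {n : ℕ} (K : Type*) [Field K] (J : Ideal (MvPolynomial (Fin n) K))
    (m : Mon n) : Set ℕ :=
  { j | j < n ∧ monomial (m + sing n j) (1 : K) ∈ idealBelow K J m }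

/-- The order `≺` on monomials: compare first the degree of the part supported in
`x_1,…,x_l`, then `<_lex`. -/
def precLT {n : ℕ} (l : ℕ) (m₁ m₂ : Mon n) : Prop :=
  deg (lowPart l m₁) < deg (lowPart l m₂) ∨
    (deg (lowPart l m₁) = deg (lowPart l m₂) ∧ lexLT m₁ m₂)

/-- `w = g(z)`: `w` is the `<_revlex`-smallest minimal monomial generator of `J`
dividing the monomial `z` (the value of the decomposition function). -/
def isDecompOf {n : ℕ} (K : Type*) [Field K] (J : Ideal (MvPolynomial (Fin n) K))
    (z w : Mon n) : Prop :=
  w ∈ minGens K J ∧ w ≤ z ∧ ∀ w' ∈ minGens K J, w' ≤ z → revLE w w'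

theorem sing_eq {n j : ℕ} (h : j < n) : sing n j = Finsupp.single ⟨j, h⟩ 1 := by
  ext i
  simp only [sing, Finsupp.onFinset_apply, Finsupp.single_apply, Fin.ext_iff, eq_comm]

theorem deg_eq {n : ℕ} (m : Mon n) : deg m = ∑ i, m i := by
  unfold deg
  exact Finsupp.sum_fintype _ _ (by simp)

/-- degree of the low part, as a sum -/
def ld {n : ℕ} (l : ℕ) (m : Mon n) : ℕ := ∑ i : Fin n, if (i : ℕ) < l then m i else 0

theorem deg_low {n l : ℕ} (m : Mon n) : deg (lowPart l m) = ld l m := by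
  rw [deg_eq]
  simp [ld, lowPart, Finsupp.filter_apply]

theorem deg_add' {n : ℕ} (x y : Mon n) : deg (x + y) = deg x + deg y := by
  simp [deg_eq, Finset.sum_add_distrib]

theorem ld_add {n l : ℕ} (x y : Mon n) : ld l (x + y) = ld l x + ld l y := by
  simp only [ld, ← Finset.sum_add_distrib, Finsupp.add_apply]
  exact Finset.sum_congr rfl fun i _ => by split_ifs <;> simp

theorem deg_single {n : ℕ} (t : Fin n) : deg (Finsupp.single t 1) = 1 := by
  simp [deg_eq, Finsupp.single_apply]

theorem ld_single {n l : ℕ} (t : Fin n) :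
    ld l (Finsupp.single t 1) = if (t : ℕ) < l then 1 else 0 := by
  rw [ld, Finset.sum_eq_single t]
  · simp
  · intro b _ hb
    simp [Finsupp.single_apply, Ne.symm hb]
  · simp

/-- sums of `k` elements of `S` -/
def PS {n : ℕ} (S : Set (Mon n)) : ℕ → Set (Mon n)
  | 0 => {0}
  | k + 1 => {z | ∃ x ∈ PS S k, ∃ y ∈ S, z = x + y}

theorem span_PS {n : ℕ} (K : Type*) [Field K] (S : Set (Mon n)) (k : ℕ) :
    (Ideal.span ((fun w => monomial w (1 : K)) '' S)) ^ k =
      Ideal.span ((fun w => monomial w (1 : K)) '' PS S k) := by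
  induction k with
  | zero =>
    simp [PS]
  | succ k ih =>
    rw [pow_succ, ih, Ideal.span_mul_span']
    congr 1
    ext z
    simp only [Set.mem_mul, Set.mem_image, PS, Set.mem_setOf_eq]
    constructor
    · rintro ⟨_, ⟨x, hx, rfl⟩, _, ⟨y, hy, rfl⟩, rfl⟩
      exact ⟨x + y, ⟨x, hx, y, hy, rfl⟩, by simp [monomial_mul]⟩
    · rintro ⟨_, ⟨x, hx, y, hy, rfl⟩, rfl⟩
      exact ⟨_, ⟨x, hx, rfl⟩, _, ⟨y, hy, rfl⟩, by simp [monomial_mul]⟩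

theorem mem_span_mon {n : ℕ} (K : Type*) [Field K] (S : Set (Mon n)) (m : Mon n) :
    monomial m (1 : K) ∈ Ideal.span ((fun w => monomial w (1 : K)) '' S) ↔ ∃ x ∈ S, x ≤ m := by
  rw [mem_ideal_span_monomial_image]
  simp [support_monomial]

theorem deg_mono {n : ℕ} {x y : Mon n} (h : x ≤ y) : deg x ≤ deg y := by
  rw [deg_eq, deg_eq]
  exact Finset.sum_le_sum fun i _ => h i

theorem sub_single_add {n : ℕ} {m : Mon n} {i : Fin n} (h : m i ≠ 0) :
    m - Finsupp.single i 1 + Finsupp.single i 1 = m := by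
  apply tsub_add_cancel_of_le
  rw [Finsupp.single_le_iff]
  omega

theorem minGens_PS {n : ℕ} (K : Type*) [Field K] (S : Set (Mon n)) (k e : ℕ)
    (hS : ∀ x ∈ PS S k, deg x = e) :
    minGens K ((Ideal.span ((fun w => monomial w (1 : K)) '' S)) ^ k) = PS S k := by
  rw [span_PS]
  ext m
  simp only [minGens, Set.mem_setOf_eq, mem_span_mon]
  constructor
  · rintro ⟨⟨x, hx, hxm⟩, h⟩
    by_cases hne : x = m
    · exact hne ▸ hx
    · exfalso
      obtain ⟨i, hi⟩ : ∃ i, x i ≠ m i := by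
        by_contra hc
        push Not at hc
        exact hne (Finsupp.ext hc)
      have hi' : x i < m i := lt_of_le_of_ne (hxm i) hi
      refine h i (by simp; omega) ⟨x, hx, fun j => ?_⟩
      have := hxm j
      simp only [Finsupp.tsub_apply, Finsupp.single_apply]
      split_ifs with hj
      · subst hj; omega
      · omega
  · intro hm
    refine ⟨⟨m, hm, le_rfl⟩, ?_⟩
    rintro i hi ⟨x, hx, hxm⟩
    have h1 := deg_mono hxm
    have h2 := deg_add' (m - Finsupp.single i 1) (Finsupp.single i 1)
    rw [sub_single_add (by simpa using hi), deg_single, hS m hm] at h2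
    rw [hS x hx] at h1
    omega

theorem vVec_apply {n l d : ℕ} (i : Fin n) :
    vVec n l d i = (if (i : ℕ) = l - 1 then 1 else 0) + (d - 1) * (if (i : ℕ) = n - 1 then 1 else 0) := by
  simp [vVec, sing]

theorem vVec_split {n l d : ℕ} (hl2 : 2 ≤ l) (hln : l ≤ n - 1) :
    vVec n l d = Finsupp.single ⟨l - 1, by omega⟩ 1 +
      (d - 1) • Finsupp.single ⟨n - 1, by omega⟩ 1 := by
  rw [vVec, sing_eq, sing_eq]

theorem deg_smul' {n : ℕ} (k : ℕ) (x : Mon n) : deg (k • x) = k * deg x := by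
  simp [deg_eq, Finset.mul_sum]

theorem ld_smul {n l : ℕ} (k : ℕ) (x : Mon n) : ld l (k • x) = k * ld l x := by
  simp [ld, Finset.mul_sum]

theorem deg_v {n l d : ℕ} (hd : 2 ≤ d) (hl2 : 2 ≤ l) (hln : l ≤ n - 1) :
    deg (vVec n l d) = d := by
  rw [vVec_split hl2 hln, deg_add', deg_smul', deg_single, deg_single]; omega

theorem ld_v {n l d : ℕ} (hl2 : 2 ≤ l) (hln : l ≤ n - 1) :
    ld l (vVec n l d) = 1 := by
  rw [vVec_split hl2 hln, ld_add, ld_smul, ld_single, ld_single]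
  simp only
  rw [if_pos (by omega), if_neg (by omega), mul_zero, add_zero]

theorem ld_pos_iff {n l : ℕ} (w : Mon n) (i : Fin n) (hi : (i : ℕ) < l) : w i ≤ ld l w := by
  have := Finset.single_le_sum (f := fun i : Fin n => if (i : ℕ) < l then w i else 0)
    (fun _ _ => Nat.zero_le _) (Finset.mem_univ i)
  simpa [ld, hi] using this

theorem seg_ld {n l d : ℕ} {a : ℕ → ℕ} (hl2 : 2 ≤ l) (hln : l ≤ n - 1)
    {w : Mon n} (hw : w ∈ lexSeg n l d a) : 1 ≤ ld l w := by
  obtain ⟨-, hv, -⟩ := hw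
  by_contra hc
  have h0 : ∀ i : Fin n, (i : ℕ) < l → w i = 0 := fun i hi => by
    have := ld_pos_iff w i hi
    omega
  have hv1 : 1 ≤ vVec n l d ⟨l - 1, by omega⟩ := by rw [vVec_apply]; simp
  have hw1 := h0 ⟨l - 1, by omega⟩ (by simp; omega)
  rcases hv with rfl | ⟨i, hi, hlt⟩
  · omega
  · by_cases hil : (i : ℕ) < l
    · have := h0 i hil; omega
    · have := hi ⟨l - 1, by omega⟩ (by rw [Fin.lt_def]; simp; omega)
      omega

theorem PS_deg {n l d : ℕ} {a : ℕ → ℕ} (hl2 : 2 ≤ l) (hln : l ≤ n - 1) (k : ℕ) :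
    ∀ x ∈ PS (lexSeg n l d a) k, deg x = k * d ∧ k ≤ ld l x := by
  induction k with
  | zero => intro x hx; simp [PS] at hx; subst hx; simp [deg_eq]
  | succ k ih =>
    rintro _ ⟨x, hx, y, hy, rfl⟩
    obtain ⟨h1, h2⟩ := ih x hx
    have h3 := seg_ld hl2 hln hy
    rw [deg_add', ld_add, h1, hy.1]
    constructor
    · ring
    · omega

theorem lex_tri {n : ℕ} (x y : Mon n) : lexLE x y ∨ lexLT y x := by
  by_cases h : x = y
  · exact Or.inl (Or.inl h)
  have hex : ∃ j : ℕ, ∃ h : j < n, x ⟨j, h⟩ ≠ y ⟨j, h⟩ := by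
    by_contra hc
    push Not at hc
    exact h (Finsupp.ext fun i => hc i i.2)
  classical
  obtain ⟨hj, hne⟩ := Nat.find_spec hex
  have hmin : ∀ j : Fin n, j < ⟨Nat.find hex, hj⟩ → x j = y j := by
    intro j hjl
    by_contra hc
    exact Nat.find_min hex (Fin.lt_def.1 hjl) ⟨j.2, hc⟩
  rcases lt_or_gt_of_ne hne with h1 | h1
  · exact Or.inl (Or.inr ⟨_, hmin, h1⟩)
  · exact Or.inr ⟨_, fun j hj => (hmin j hj).symm, h1⟩

theorem lexLT_trans {n : ℕ} {x y z : Mon n} (h1 : lexLT x y) (h2 : lexLT y z) : lexLT x z := by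
  obtain ⟨i, hi, hi'⟩ := h1
  obtain ⟨j, hj, hj'⟩ := h2
  rcases lt_trichotomy i j with h | h | h
  · exact ⟨i, fun q hq => (hi q hq).trans (hj q (hq.trans h)), by rw [← hj i h]; exact hi'⟩
  · subst h
    exact ⟨i, fun q hq => (hi q hq).trans (hj q hq), by omega⟩
  · exact ⟨j, fun q hq => (hi q (hq.trans h)).trans (hj q hq), by rw [hi j h]; exact hj'⟩

theorem not_lex_v {n l d k : ℕ} (hd : 2 ≤ d) (hl2 : 2 ≤ l) (hln : l ≤ n - 1) {w : Mon n}
    (hw : deg w = k * d) (hw' : k ≤ ld l w) : ¬ lexLT w (k • vVec n l d) := by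
  rintro ⟨i, hi, hlt⟩
  have hle : ∀ j : Fin n, j ≤ i → w j ≤ (k • vVec n l d) j := fun j hj => by
    rcases hj.lt_or_eq with h | h
    · exact (hi j h).le
    · subst h; exact hlt.le
  have hpos : (i : ℕ) = l - 1 ∨ (i : ℕ) = n - 1 := by
    by_contra hc
    push Not at hc
    simp [vVec_apply, hc.1, hc.2] at hlt
  rcases hpos with h | h
  · have : ld l w < ld l (k • vVec n l d) := by
      unfold ld
      apply Finset.sum_lt_sum
      · intro j _
        split_ifs with hj
        · exact hle j (by rw [Fin.le_def]; omega)
        · exact le_rfl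
      · exact ⟨i, Finset.mem_univ _, by rw [if_pos (by omega), if_pos (by omega)]; exact hlt⟩
    rw [ld_smul, ld_v hl2 hln] at this
    omega
  · have : deg w < deg (k • vVec n l d) := by
      rw [deg_eq, deg_eq]
      apply Finset.sum_lt_sum
      · intro j _
        exact hle j (by rw [Fin.le_def]; omega)
      · exact ⟨i, Finset.mem_univ _, hlt⟩
    rw [deg_smul', deg_v hd hl2 hln] at this
    omega

theorem seg_swap {n l d : ℕ} {a : ℕ → ℕ} (hd : 2 ≤ d) (hl2 : 2 ≤ l) (hln : l ≤ n - 1)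
    {w w' : Mon n} {s t : Fin n} (hw : w ∈ lexSeg n l d a) (ht : l ≤ (t : ℕ)) (hts : t < s)
    (h : w' + Finsupp.single t 1 = w + Finsupp.single s 1) : w' ∈ lexSeg n l d a := by
  have hD := congrArg deg h
  have hL := congrArg (ld l) h
  rw [deg_add', deg_add', deg_single, deg_single, hw.1] at hD
  have hts' : (t : ℕ) < s := hts
  rw [ld_add, ld_add, ld_single, ld_single, if_neg (by omega), if_neg (by omega)] at hL
  have h1 := seg_ld hl2 hln hw
  refine ⟨by omega, ?_, ?_⟩
  · rcases lex_tri (vVec n l d) w' with h | h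
    · exact h
    · exact absurd (by simpa using h)
        (not_lex_v (k := 1) (w := w') hd hl2 hln (by omega) (by omega))
  · have : lexLT w' w := by
      refine ⟨t, fun j hj => ?_, ?_⟩
      · have := DFunLike.congr_fun h j
        simpa [Finsupp.single_apply, hj.ne', (hj.trans hts).ne'] using this
      · have := DFunLike.congr_fun h t
        simp [Finsupp.single_apply, hts.ne'] at this
        omega
    rcases hw.2.2 with rfl | h
    · exact Or.inr this
    · exact Or.inr (lexLT_trans this h)

theorem PS_swap {n l d : ℕ} {a : ℕ → ℕ} (hd : 2 ≤ d) (hl2 : 2 ≤ l) (hln : l ≤ n - 1)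
    {s t : Fin n} (ht : l ≤ (t : ℕ)) (hts : t < s) (k : ℕ) :
    ∀ x ∈ PS (lexSeg n l d a) k, x t ≠ 0 → 
      x - Finsupp.single t 1 + Finsupp.single s 1 ∈ PS (lexSeg n l d a) k := by
  induction k with
  | zero => intro x hx; simp [PS] at hx; subst hx; simp
  | succ k ih =>
    rintro _ ⟨x, hx, y, hy, rfl⟩ h0
    by_cases hyt : y t = 0
    · have hxt : x t ≠ 0 := by simpa [hyt] using h0
      refine ⟨_, ih x hx hxt, y, hy, ?_⟩
      conv_lhs => rw [← sub_single_add hxt]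
      ext j; simp; omega
    · refine ⟨x, hx, y - Finsupp.single t 1 + Finsupp.single s 1,
        seg_swap hd hl2 hln hy ht hts ?_, ?_⟩
      · rw [add_right_comm, sub_single_add hyt]
      · conv_lhs => rw [← sub_single_add hyt]
        ext j; simp; omega

theorem exists_single {n : ℕ} {x y : Mon n} (h : x ≤ y) (hd : deg y = deg x + 1) :
    ∃ t : Fin n, x + Finsupp.single t 1 = y := by
  obtain ⟨c, rfl⟩ := exists_add_of_le h
  rw [deg_add'] at hd
  have hc : deg c = 1 := by omega
  obtain ⟨t, ht⟩ : ∃ t, c t ≠ 0 := by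
    by_contra hh
    push Not at hh
    rw [deg_eq] at hc
    simp [hh] at hc
  refine ⟨t, ?_⟩
  have h1 := sub_single_add ht
  have h2 := deg_add' (c - Finsupp.single t 1) (Finsupp.single t 1)
  rw [h1, hc, deg_single] at h2
  have h3 : ∀ i, (c - Finsupp.single t 1 : Mon n) i = 0 := by
    have : ∑ i, (c - Finsupp.single t 1 : Mon n) i = 0 := by rw [← deg_eq]; omega
    simpa only [Finset.sum_eq_zero_iff, Finset.mem_univ, true_implies] using this
  have h4 : c - Finsupp.single t 1 = 0 := Finsupp.ext h3
  rw [h4, zero_add] at h1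
  rw [h1]

theorem minIdx_spec {n : ℕ} {m : Mon n} {i : Fin n} (h : m i ≠ 0) :
    ∃ hh : minIdx m < n, m ⟨minIdx m, hh⟩ ≠ 0 :=
  Nat.sInf_mem (s := {j : ℕ | ∃ h : j < n, m ⟨j, h⟩ ≠ 0}) ⟨i, i.2, h⟩

theorem minIdx_le {n : ℕ} {m : Mon n} {i : Fin n} (h : m i ≠ 0) : minIdx m ≤ i :=
  Nat.sInf_le (s := {j : ℕ | ∃ h : j < n, m ⟨j, h⟩ ≠ 0}) ⟨i.2, h⟩

/-- If `m ∈ G(I^k)`, `s ∈ set(m)` and `x_s·m/x_{min(m)} ≺ v^k`, then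
`g(x_s·m) = x_s·m/x_{min(m̃)}`: the latter lies in `G(I^k)` and every
`w ∈ G(I^k)` dividing `x_s·m` satisfies `w ≥_revlex x_s·m/x_{min(m̃)}`. -/
theorem stmt11 (n d l k : ℕ) (K : Type*) [Field K] (a : ℕ → ℕ)
    (hd : 2 ≤ d) (hl2 : 2 ≤ l) (hln : l ≤ n - 1)
    (hsum : ∑ j ∈ Finset.Ico l n, a j = d - 1) (hk : 1 ≤ k) :
    ∀ m ∈ minGens K ((lexIdeal n l d a K) ^ k),
      ∀ s ∈ setOfGen K ((lexIdeal n l d a K) ^ k) m,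
        precLT l (m + sing n s - sing n (minIdx m)) (k • vVec n l d) →
          m + sing n s - sing n (minIdx (highPart l m)) ∈
            minGens K ((lexIdeal n l d a K) ^ k) ∧
          ∀ w ∈ minGens K ((lexIdeal n l d a K) ^ k), w ≤ m + sing n s →
            revLE (m + sing n s - sing n (minIdx (highPart l m))) w := by
  intro m hm s hs hprec
  have hPS := PS_deg (a := a) (d := d) hl2 hln k
  have hG : minGens K ((lexIdeal n l d a K) ^ k) = PS (lexSeg n l d a) k :=
    minGens_PS K _ k (k * d) fun x hx => (hPS x hx).1
  obtain ⟨hsn, hs⟩ := hs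
  unfold idealBelow at hs
  rw [mem_span_mon] at hs
  obtain ⟨z, ⟨hz, hzm⟩, hzle⟩ := hs
  rw [hG] at hm hz ⊢
  rw [sing_eq hsn] at *
  obtain ⟨s, rfl⟩ : ∃ s' : Fin n, (s' : ℕ) = s := ⟨⟨s, hsn⟩, rfl⟩
  simp only [Fin.eta] at *
  obtain ⟨hmd, hml⟩ := hPS m hm
  obtain ⟨hzd, hzl⟩ := hPS z hz
  have hkd : 0 < k * d := Nat.mul_pos (by omega) (by omega)
  obtain ⟨i0, hi0⟩ : ∃ i, m i ≠ 0 := by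
    by_contra hh
    push Not at hh
    rw [deg_eq] at hmd
    simp [hh] at hmd
    omega
  obtain ⟨hpn, hp⟩ := minIdx_spec hi0
  rw [sing_eq hpn] at hprec
  set p : Fin n := ⟨minIdx m, hpn⟩
  have hM : m + Finsupp.single s 1 - Finsupp.single p 1 + Finsupp.single p 1
      = m + Finsupp.single s 1 := sub_single_add (by simp [hp])
  have hMd := congrArg deg hM
  have hMl := congrArg (ld l) hM
  rw [deg_add', deg_add', deg_single, deg_single] at hMd
  rw [ld_add, ld_add, ld_single, ld_single] at hMl
  have hlow : ld l (m + Finsupp.single s 1 - Finsupp.single p 1) < k := by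
    by_contra hc
    rcases hprec with h | ⟨-, h⟩
    · rw [deg_low, deg_low, ld_smul, ld_v hl2 hln] at h
      omega
    · exact not_lex_v hd hl2 hln (by omega) (by omega) h
  have hsl : l ≤ (s : ℕ) := by
    by_contra hc
    rw [if_pos (by omega : (s : ℕ) < l)] at hMl
    split_ifs at hMl <;> omega
  rw [if_neg (by omega : ¬ (s : ℕ) < l)] at hMl
  have hmk : ld l m = k := by split_ifs at hMl <;> omega
  -- every generator dividing `x_s m`
  have key : ∀ w ∈ PS (lexSeg n l d a) k, w ≤ m + Finsupp.single s 1 →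
      ∃ t : Fin n, l ≤ (t : ℕ) ∧ w + Finsupp.single t 1 = m + Finsupp.single s 1 := by
    intro w hw hle
    obtain ⟨hwd, hwl⟩ := hPS w hw
    obtain ⟨t, ht⟩ := exists_single hle (by rw [deg_add', deg_single]; omega)
    refine ⟨t, ?_, ht⟩
    by_contra hc
    have := congrArg (ld l) ht
    rw [ld_add, ld_add, ld_single, ld_single, if_pos (by omega), if_neg (by omega)] at this
    omega
  obtain ⟨t, htl, ht⟩ := key z hz hzle
  have hpt : ∀ i, z i + (Finsupp.single t 1 : Mon n) i = m i + (Finsupp.single s 1 : Mon n) i :=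
    fun i => DFunLike.congr_fun ht i
  simp only [Finsupp.single_apply] at hpt
  obtain ⟨q, hq, hq'⟩ := hzm
  have hqs : s = q := by
    by_contra hc
    have := hpt q
    rw [if_neg hc] at this
    split_ifs at this <;> omega
  subst hqs
  have hts : t < s := by
    rcases lt_trichotomy t s with h | h | h
    · exact h
    · subst h
      have := hpt t
      simp at this; omega
    · have h1 := hq t h
      have := hpt t
      rw [if_pos rfl, if_neg h.ne] at this
      omega
  have hmt : m t ≠ 0 := by
    have := hpt t
    rw [if_pos rfl, if_neg hts.ne'] at this
    omega
  have hH : ∀ i : Fin n, highPart l m i = if l ≤ (i : ℕ) then m i else 0 := fun i => by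
    simp [highPart, Finsupp.filter_apply]
  have hHt : highPart l m t ≠ 0 := by rw [hH, if_pos htl]; exact hmt
  obtain ⟨hrn, hr⟩ := minIdx_spec hHt
  have hrt := minIdx_le hHt
  have hrmin : ∀ i : Fin n, l ≤ (i : ℕ) → m i ≠ 0 → minIdx (highPart l m) ≤ i := fun i hi hi' =>
    minIdx_le (by rw [hH, if_pos hi]; exact hi')
  rw [sing_eq hrn]
  obtain ⟨r, hr0⟩ : ∃ r : Fin n, r = ⟨minIdx (highPart l m), hrn⟩ := ⟨_, rfl⟩
  have hrv : (r : ℕ) = minIdx (highPart l m) := by rw [hr0]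
  rw [← hr0] at hr ⊢
  rw [← hrv] at hrt hrmin
  rw [hH] at hr
  have hrl : l ≤ (r : ℕ) := by
    by_contra hc
    simp [hc] at hr
  rw [if_pos hrl] at hr
  have hrs : r < s := lt_of_le_of_lt (Fin.le_def.2 hrt) hts
  have hR : m + Finsupp.single s 1 - Finsupp.single r 1 + Finsupp.single r 1
      = m + Finsupp.single s 1 := sub_single_add (by simp [hr])
  constructor
  · have := PS_swap hd hl2 hln hrl hrs k m hm hr
    convert this using 1
    apply add_right_cancel (b := (Finsupp.single r 1 : Mon n))
    rw [hR, add_right_comm, sub_single_add hr]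
  · intro w hw hle
    obtain ⟨t', htl', ht'⟩ := key w hw hle
    rcases lt_trichotomy r t' with h | h | h
    · right
      rw [← hR] at ht'
      refine ⟨t', fun i hi => ?_, ?_⟩
      · have := DFunLike.congr_fun ht' i
        simp only [Finsupp.add_apply, Finsupp.single_apply, if_neg hi.ne, if_neg (h.trans hi).ne] at this
        omega
      · have := DFunLike.congr_fun ht' t'
        simp only [Finsupp.add_apply, Finsupp.single_apply, if_neg h.ne, if_true] at this
        omega
    · left
      subst h
      exact add_right_cancel (hR.trans ht'.symm)
    · exfalso
      have := DFunLike.congr_fun ht' t'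
      simp only [Finsupp.add_apply, Finsupp.single_apply, if_neg (h.trans hrs).ne', if_true] at this
      have := hrmin t' htl' (by omega)
      have h' : (t' : ℕ) < r := h
      omega
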